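/- In the pathwise processor-sharing queue, let T > 1 and r > 0, and suppose there are constants t_0 ∈ [0, rT] and t_1, c, l > 0 such that: (i) sup_{t∈[t_0, t_0+t_1]} (Ē^r(t+l) − Ē^r(t)) ≤ c/4; (ii) sup_{t∈[t_0, t_0+t_1]} ⟨χ, μ̄^r(t)⟩ ≤ l/4; (iii) ⟨1, μ̄^r(t_0)⟩ ≤ c/2. Then sup_{t∈[t_0, t_0+t_1]} ⟨1, μ̄^r(t)⟩ ≤ c. -/

import Mathlib

open MeasureTheory Filter Set
noncomputable section
namespace PSQ

/-- ⟨g, ζ⟩ = ∫ g dζ -/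
def pair (g : ℝ → ℝ) (ζ : Measure ℝ) : ℝ := ∫ x, g x ∂ζ

/-- total mass ⟨1, ζ⟩ of a finite measure, as a real number -/
def mass (ζ : Measure ℝ) : ℝ := (ζ Set.univ).toReal

/-- truncated Dirac measure δ⁺ₓ -/
def dplus (x : ℝ) : Measure ℝ := if 0 < x then Measure.dirac x else 0

/-- positive part x⁺ -/
def pos (x : ℝ) : ℝ := max x 0

/-- the arrival counting process E(t) = sup{i : U i ≤ t} -/
def Ecount (U : ℕ → ℝ) (t : ℝ) : ℕ := sSup {i : ℕ | U i ≤ t}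

/-- the standing hypotheses on the data of a pathwise processor sharing queue:
nondecreasing arrival times with `U 0 = 0`, `U 1 > 0`, `U i → ∞`, and strictly positive
service times and initial service times. -/
def QueueHyps (U v : ℕ → ℝ) (Z0 : ℕ) (vt : ℕ → ℝ) : Prop :=
  U 0 = 0 ∧ Monotone U ∧ 0 < U 1 ∧ Tendsto U atTop atTop ∧
    (∀ i, 1 ≤ i → 0 < v i) ∧ (∀ j, 1 ≤ j → 0 < vt j)

/-- the defining equations of the state descriptor μ and the cumulative service per
job S:  `S t = ∫_0^t φ(⟨1, μ(s)⟩) ds` (recall `(0:ℝ)⁻¹ = 0` in Lean, matching φ(0)=0)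
and `μ(t) = Σ_j δ⁺_{(ṽ_j - S(t))⁺} + Σ_{i ≤ E(t)} δ⁺_{(v_i - S(t) + S(U_i))⁺}`. -/
def StateEqns (U v : ℕ → ℝ) (Z0 : ℕ) (vt : ℕ → ℝ)
    (μ : ℝ → Measure ℝ) (S : ℝ → ℝ) : Prop :=
  ∀ t, 0 ≤ t →
    (S t = ∫ s in (0:ℝ)..t, (mass (μ s))⁻¹) ∧
    μ t = (∑ j ∈ Finset.range Z0, dplus (pos (vt (j+1) - S t)))
        + ∑ i ∈ Finset.range (Ecount U t), dplus (pos (v (i+1) - S t + S (U (i+1))))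

/-- fluid scaled state descriptor μ̄^r(t) = r⁻¹ μ(rt) -/
def fmu (μ : ℝ → Measure ℝ) (r t : ℝ) : Measure ℝ := ENNReal.ofReal (1/r) • μ (r*t)

/-- fluid scaled arrival process Ē^r(t) = r⁻¹ E(rt) -/
def fE (U : ℕ → ℝ) (r t : ℝ) : ℝ := (Ecount U (r*t) : ℝ) / r

/-- fluid scaled cumulative service S̄^r_{t,t'} = S(r t') - S(r t) -/
def fS (S : ℝ → ℝ) (r t t' : ℝ) : ℝ := S (r*t') - S (r*t)

end PSQ
end

namespace PSQ

/-- indicator of the open half line of positive reals -/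
noncomputable def alive (x : ℝ) : ℝ := if 0 < x then 1 else 0

theorem alive_nonneg (x : ℝ) : 0 ≤ alive x := by unfold alive; split_ifs <;> norm_num

theorem alive_le_one (x : ℝ) : alive x ≤ 1 := by unfold alive; split_ifs <;> norm_num

theorem alive_mono : Monotone alive := by
  intro x y h
  unfold alive
  split_ifs with h1 h2 <;> first | exact absurd (h1.trans_le h) h2 | norm_num

theorem alive_mul_le_pos (x y : ℝ) : alive x * (y - x) ≤ pos y := by
  unfold alive pos
  split_ifs with hx
  · exact le_max_of_le_left (by linarith)
  · simp

theorem dplus_pos (x : ℝ) : dplus (pos x) = if 0 < x then Measure.dirac x else 0 := by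
  unfold dplus pos
  by_cases hx : 0 < x
  · simp [hx, max_eq_left hx.le]
  · simp [hx]

theorem dplus_pos_univ (x : ℝ) :
    dplus (pos x) Set.univ = ENNReal.ofReal (alive x) := by
  rw [dplus_pos]; unfold alive
  split_ifs <;> simp

theorem integrable_dplus_pos (x : ℝ) : Integrable id (dplus (pos x)) := by
  rw [dplus_pos]
  split_ifs
  · exact integrable_dirac (by simp)
  · exact integrable_zero_measure

theorem pair_dplus_pos (x : ℝ) : ∫ y, id y ∂(dplus (pos x)) = pos x := by
  rw [dplus_pos]
  unfold pos
  split_ifs with hx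
  · simp [max_eq_left hx.le]
  · simp [max_eq_right (not_lt.mp hx)]

theorem sum_dplus_univ {ι : Type*} (s : Finset ι) (a : ι → ℝ) :
    (∑ i ∈ s, dplus (pos (a i))) Set.univ = ENNReal.ofReal (∑ i ∈ s, alive (a i)) := by
  rw [ENNReal.ofReal_sum_of_nonneg fun i _ ↦ alive_nonneg _, Measure.finsetSum_apply]
  exact Finset.sum_congr rfl fun i _ ↦ dplus_pos_univ _

section Queue

variable {U v : ℕ → ℝ} {Z0 : ℕ} {vt : ℕ → ℝ} {μ : ℝ → Measure ℝ} {S : ℝ → ℝ}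

theorem lt_Ecount_iff (hq : QueueHyps U v Z0 vt) {t : ℝ} (ht : 0 ≤ t) (i : ℕ) :
    i < Ecount U t ↔ U (i + 1) ≤ t := by
  obtain ⟨h0, hmono, -, htop, -⟩ := hq
  obtain ⟨n, hn⟩ := (htop.eventually_gt_atTop t).exists
  have hbdd : BddAbove {i : ℕ | U i ≤ t} := by
    refine ⟨n, fun k hk ↦ ?_⟩
    by_contra! hlt
    exact absurd (hmono hlt.le) (not_le.mpr (lt_of_le_of_lt hk hn))
  constructor
  · intro h
    have hmem : U (Ecount U t) ≤ t := Nat.sSup_mem ⟨0, by simpa [h0] using ht⟩ hbdd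
    exact (hmono h).trans hmem
  · intro h
    exact Nat.lt_of_succ_le (le_csSup hbdd h)

theorem Ecount_mono (hq : QueueHyps U v Z0 vt) {s t : ℝ} (hs : 0 ≤ s) (hst : s ≤ t) :
    Ecount U s ≤ Ecount U t := by
  by_contra! h
  have h1 := (lt_Ecount_iff hq hs _).mp h
  exact lt_irrefl _ ((lt_Ecount_iff hq (hs.trans hst) _).mpr (h1.trans hst))

theorem mass_eq (h : StateEqns U v Z0 vt μ S) {t : ℝ} (ht : 0 ≤ t) :
    mass (μ t) = ∑ j ∈ Finset.range Z0, alive (vt (j + 1) - S t)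
      + ∑ i ∈ Finset.range (Ecount U t), alive (v (i + 1) - S t + S (U (i + 1))) := by
  have h1 : ∀ (n : ℕ) (a : ℕ → ℝ), 0 ≤ ∑ i ∈ Finset.range n, alive (a i) :=
    fun n a ↦ Finset.sum_nonneg fun i _ ↦ alive_nonneg _
  rw [mass, (h t ht).2, Measure.add_apply, sum_dplus_univ, sum_dplus_univ,
    ← ENNReal.ofReal_add (h1 _ _) (h1 _ _), ENNReal.toReal_ofReal (add_nonneg (h1 _ _) (h1 _ _))]

theorem exists_nat_mass_eq (h : StateEqns U v Z0 vt μ S) {t : ℝ} (ht : 0 ≤ t) :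
    ∃ n : ℕ, mass (μ t) = n := by
  refine ⟨∑ j ∈ Finset.range Z0, (if 0 < vt (j + 1) - S t then 1 else 0)
      + ∑ i ∈ Finset.range (Ecount U t),
        (if 0 < v (i + 1) - S t + S (U (i + 1)) then 1 else 0), ?_⟩
  rw [mass_eq h ht]
  push_cast
  rfl

theorem pair_eq (h : StateEqns U v Z0 vt μ S) {t : ℝ} (ht : 0 ≤ t) :
    pair id (μ t) = ∑ j ∈ Finset.range Z0, pos (vt (j + 1) - S t)
      + ∑ i ∈ Finset.range (Ecount U t), pos (v (i + 1) - S t + S (U (i + 1))) := by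
  have hint : ∀ (n : ℕ) (a : ℕ → ℝ),
      Integrable id (∑ i ∈ Finset.range n, dplus (pos (a i))) := fun n a ↦
    integrable_finsetSum_measure.mpr fun i _ ↦ integrable_dplus_pos _
  rw [pair, (h t ht).2, integral_add_measure (hint _ _) (hint _ _),
    integral_finsetSum_measure fun i _ ↦ integrable_dplus_pos _,
    integral_finsetSum_measure fun i _ ↦ integrable_dplus_pos _]
  simp only [pair_dplus_pos]

/-- A primitive of a nonnegative function is a.e. measurable, even if the interval integral takes
its default value `0` from some point on. -/
theorem aemeasurable_primitive {f : ℝ → ℝ} (hf : ∀ x, 0 ≤ f x) (T : ℝ) :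
    AEMeasurable (fun t ↦ ∫ s in (0:ℝ)..t, f s) (volume.restrict (Set.Ioc 0 T)) := by
  set A : Set ℝ := {t | 0 ≤ t ∧ IntervalIntegrable f volume 0 t} with hA
  have hsub : ∀ {s t : ℝ}, 0 ≤ s → s ≤ t → IntervalIntegrable f volume 0 t →
      IntervalIntegrable f volume 0 s := fun h0 hst h ↦ h.mono_set (by
    rw [Set.uIcc_of_le h0, Set.uIcc_of_le (h0.trans hst)]
    exact Set.Icc_subset_Icc_right hst)
  have hAm : MeasurableSet A := by
    refine Set.OrdConnected.measurableSet ⟨fun x hx y hy z hz ↦ ?_⟩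
    exact ⟨hx.1.trans hz.1, hsub (hx.1.trans hz.1) hz.2 hy.2⟩
  have hmono : MonotoneOn (fun t ↦ ∫ s in (0:ℝ)..t, f s) A := fun s hs t ht hst ↦
    intervalIntegral.integral_mono_interval le_rfl hs.1 hst
      (Filter.Eventually.of_forall hf) ht.2
  have h1 := aemeasurable_restrict_of_monotoneOn (μ := volume) hAm hmono
  have h2 : AEMeasurable (fun t ↦ ∫ s in (0:ℝ)..t, f s)
      (volume.restrict (Set.Ioc 0 T \ A)) := by
    refine (aemeasurable_const (b := (0:ℝ))).congr ?_
    refine (ae_restrict_iff' (measurableSet_Ioc.diff hAm)).mpr (Filter.Eventually.of_forall ?_)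
    intro t ht
    exact (intervalIntegral.integral_undef fun hi ↦ ht.2 ⟨ht.1.1.le, hi⟩).symm
  refine (aemeasurable_union_iff.mpr ⟨h1, h2⟩).mono_set ?_
  intro t ht
  by_cases h : t ∈ A
  · exact Or.inl h
  · exact Or.inr ⟨ht, h⟩

theorem mass_inv_nonneg (t : ℝ) : 0 ≤ (mass (μ t))⁻¹ := inv_nonneg.mpr ENNReal.toReal_nonneg

theorem aemeasurable_mass (hq : QueueHyps U v Z0 vt) (h : StateEqns U v Z0 vt μ S) (T : ℝ) :
    AEMeasurable (fun t ↦ mass (μ t)) (volume.restrict (Set.Ioc 0 T)) := by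
  have hS : AEMeasurable S (volume.restrict (Set.Ioc 0 T)) := by
    refine (aemeasurable_primitive (f := fun t ↦ (mass (μ t))⁻¹) mass_inv_nonneg T).congr ?_
    refine (ae_restrict_iff' measurableSet_Ioc).mpr (Filter.Eventually.of_forall ?_)
    exact fun t ht ↦ ((h t ht.1.le).1).symm
  have hal : Measurable alive := alive_mono.measurable
  have key : AEMeasurable (fun t ↦ ∑ j ∈ Finset.range Z0, alive (vt (j + 1) - S t)
      + ∑ i ∈ Finset.range (Ecount U T), (Set.Ici (U (i + 1))).indicator
        (fun t ↦ alive (v (i + 1) - S t + S (U (i + 1)))) t)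
      (volume.restrict (Set.Ioc 0 T)) := by
    refine AEMeasurable.add ?_ ?_
    · exact Finset.aemeasurable_fun_sum _ fun j _ ↦ hal.comp_aemeasurable (hS.const_sub _)
    · exact Finset.aemeasurable_fun_sum _ fun i _ ↦
        (hal.comp_aemeasurable ((hS.const_sub _).add_const _)).indicator measurableSet_Ici
  refine key.congr ((ae_restrict_iff' measurableSet_Ioc).mpr (Filter.Eventually.of_forall ?_))
  intro t ht
  have hE : Finset.range (Ecount U t) ⊆ Finset.range (Ecount U T) :=
    Finset.range_mono (Ecount_mono hq ht.1.le ht.2)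
  simp only
  rw [mass_eq h ht.1.le, ← Finset.sum_subset hE]
  · congr 1
    refine Finset.sum_congr rfl fun i hi ↦ ?_
    exact Set.indicator_of_mem
      (Set.mem_Ici.mpr ((lt_Ecount_iff hq ht.1.le i).mp (Finset.mem_range.mp hi))) _
  · intro i _ hi
    refine Set.indicator_of_notMem (fun hm ↦ hi ?_) _
    exact Finset.mem_range.mpr ((lt_Ecount_iff hq ht.1.le i).mpr hm)

theorem intervalIntegrable_mass_inv (hq : QueueHyps U v Z0 vt) (h : StateEqns U v Z0 vt μ S)
    {t : ℝ} (ht : 0 ≤ t) : IntervalIntegrable (fun s ↦ (mass (μ s))⁻¹) volume 0 t := by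
  rw [intervalIntegrable_iff_integrableOn_Ioc_of_le ht]
  refine Integrable.of_bound (aemeasurable_mass hq h t).inv.aestronglyMeasurable 1 ?_
  refine (ae_restrict_iff' measurableSet_Ioc).mpr (Filter.Eventually.of_forall fun s hs ↦ ?_)
  obtain ⟨n, hn⟩ := exists_nat_mass_eq h hs.1.le
  rw [Real.norm_of_nonneg (mass_inv_nonneg s), hn]
  exact Nat.cast_inv_le_one n

theorem service_sub (hq : QueueHyps U v Z0 vt) (h : StateEqns U v Z0 vt μ S)
    {s t : ℝ} (hs : 0 ≤ s) (ht : 0 ≤ t) :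
    S t - S s = ∫ u in s..t, (mass (μ u))⁻¹ := by
  rw [(h t ht).1, (h s hs).1]
  exact intervalIntegral.integral_interval_sub_left (intervalIntegrable_mass_inv hq h ht)
    (intervalIntegrable_mass_inv hq h hs)

theorem service_mono (hq : QueueHyps U v Z0 vt) (h : StateEqns U v Z0 vt μ S)
    {s t : ℝ} (hs : 0 ≤ s) (hst : s ≤ t) : S s ≤ S t := by
  rw [← sub_nonneg, service_sub hq h hs (hs.trans hst)]
  exact intervalIntegral.integral_nonneg hst fun u _ ↦ mass_inv_nonneg u

/-- If the queue is nonempty and of size at most `b` on `[s, t]`, each job present receives at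
least `(t - s) / b` units of service. -/
theorem service_lower_bound (hq : QueueHyps U v Z0 vt) (h : StateEqns U v Z0 vt μ S)
    {s t b : ℝ} (hs : 0 ≤ s) (hst : s ≤ t) (hpos : ∀ u ∈ Set.Icc s t, 0 < mass (μ u))
    (hb : ∀ u ∈ Set.Icc s t, mass (μ u) ≤ b) : (t - s) * b⁻¹ ≤ S t - S s := by
  have ht := hs.trans hst
  rw [service_sub hq h hs ht, ← smul_eq_mul, ← intervalIntegral.integral_const]
  refine intervalIntegral.integral_mono_on hst intervalIntegrable_const
    ((intervalIntegrable_mass_inv hq h hs).symm.trans (intervalIntegrable_mass_inv hq h ht)) ?_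
  exact fun u hu ↦ inv_anti₀ (hpos u hu) (hb u hu)

/-- The number of jobs at time `t` that were already present at time `s` is at least the
queue length minus the number of arrivals. -/
theorem mass_sub_arrivals_le (hq : QueueHyps U v Z0 vt) (h : StateEqns U v Z0 vt μ S)
    {s t : ℝ} (hs : 0 ≤ s) (hst : s ≤ t) :
    mass (μ t) - ((Ecount U t : ℝ) - Ecount U s) ≤
      ∑ j ∈ Finset.range Z0, alive (vt (j + 1) - S t)
      + ∑ i ∈ Finset.range (Ecount U s), alive (v (i + 1) - S t + S (U (i + 1))) := by
  have hE := Ecount_mono hq hs hst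
  have h1 : ∑ i ∈ Finset.Ico (Ecount U s) (Ecount U t),
      alive (v (i + 1) - S t + S (U (i + 1))) ≤ (Ecount U t : ℝ) - Ecount U s := by
    refine (Finset.sum_le_sum fun i _ ↦ alive_le_one _).trans ?_
    simp [Nat.cast_sub hE]
  rw [mass_eq h (hs.trans hst), ← Finset.sum_range_add_sum_Ico _ hE]
  linarith

theorem mass_le_add_arrivals (hq : QueueHyps U v Z0 vt) (h : StateEqns U v Z0 vt μ S)
    {s t : ℝ} (hs : 0 ≤ s) (hst : s ≤ t) :
    mass (μ t) ≤ mass (μ s) + ((Ecount U t : ℝ) - Ecount U s) := by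
  have hS := service_mono hq h hs hst
  rw [← sub_le_iff_le_add]
  refine (mass_sub_arrivals_le hq h hs hst).trans ?_
  rw [mass_eq h hs]
  exact add_le_add (Finset.sum_le_sum fun j _ ↦ alive_mono (by linarith))
    (Finset.sum_le_sum fun i _ ↦ alive_mono (by linarith))

/-- The jobs present throughout `[s, t]` each receive `S t - S s` units of service, all of which
is part of the workload at time `s`. -/
theorem mass_mul_service_le (hq : QueueHyps U v Z0 vt) (h : StateEqns U v Z0 vt μ S)
    {s t : ℝ} (hs : 0 ≤ s) (hst : s ≤ t) :
    (mass (μ t) - ((Ecount U t : ℝ) - Ecount U s)) * (S t - S s) ≤ pair id (μ s) := by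
  have hS := service_mono hq h hs hst
  refine (mul_le_mul_of_nonneg_right (mass_sub_arrivals_le hq h hs hst)
    (sub_nonneg.mpr hS)).trans ?_
  rw [pair_eq h hs, add_mul, Finset.sum_mul, Finset.sum_mul]
  refine add_le_add (Finset.sum_le_sum fun j _ ↦ ?_) (Finset.sum_le_sum fun i _ ↦ ?_)
  · refine le_of_eq_of_le ?_ (alive_mul_le_pos (vt (j + 1) - S t) _)
    congr 1
    ring
  · refine le_of_eq_of_le ?_ (alive_mul_le_pos (v (i + 1) - S t + S (U (i + 1))) _)
    congr 1
    ring

/-- Stability of the queue length, without scaling. -/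
theorem mass_le_of_bounds (hq : QueueHyps U v Z0 vt) (h : StateEqns U v Z0 vt μ S)
    {a b c l : ℝ} (ha : 0 ≤ a) (hc : 0 < c) (hl : 0 < l)
    (harr : ∀ t ∈ Set.Icc a b, (Ecount U (t + l) : ℝ) - Ecount U t ≤ c / 4)
    (hwork : ∀ t ∈ Set.Icc a b, pair id (μ t) ≤ l / 4)
    (hinit : mass (μ a) ≤ c / 2) : ∀ t ∈ Set.Icc a b, mass (μ t) ≤ c := by
  have harr' : ∀ s u, a ≤ s → s ≤ u → u ≤ b → u ≤ s + l →
      (Ecount U u : ℝ) - Ecount U s ≤ c / 4 := by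
    intro s u has hsu hub hul
    have h1 := harr s ⟨has, hsu.trans hub⟩
    have h2 : (Ecount U u : ℝ) ≤ Ecount U (s + l) :=
      Nat.cast_le.mpr (Ecount_mono hq (ha.trans (has.trans hsu)) hul)
    linarith
  have hind : ∀ n : ℕ, ∀ t ∈ Set.Icc a b, t ≤ a + n * l → mass (μ t) ≤ c := by
    intro n
    induction n with
    | zero =>
      intro t ht hta
      have : t = a := le_antisymm (by simpa using hta) ht.1
      subst this
      linarith
    | succ n ih =>
      intro t ht htn
      push_cast at htn
      obtain htl | htl := le_total t (a + l)
      · have h1 := mass_le_add_arrivals hq h ha ht.1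
        have h2 := harr' a t le_rfl ht.1 ht.2 htl
        linarith
      have hs0 : a ≤ t - l := by linarith
      have hst : t - l ≤ t := by linarith
      have hs : 0 ≤ t - l := ha.trans hs0
      have hNs := ih (t - l) ⟨hs0, hst.trans ht.2⟩ (by linarith)
      by_contra! hlt
      have hlow : ∀ u ∈ Set.Icc (t - l) t, 0 < mass (μ u) := by
        intro u hu
        have h1 := mass_le_add_arrivals hq h (hs.trans hu.1) hu.2
        have h2 := harr' u t (hs0.trans hu.1) hu.2 ht.2 (by linarith [hu.1])
        linarith
      have hupp : ∀ u ∈ Set.Icc (t - l) t, mass (μ u) ≤ 5 * c / 4 := by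
        intro u hu
        have h1 := mass_le_add_arrivals hq h hs hu.1
        have h2 := harr' (t - l) u hs0 hu.1 (hu.2.trans ht.2) (by linarith [hu.2])
        linarith
      have h1 := service_lower_bound hq h hs hst hlow hupp
      have h2 := mass_mul_service_le hq h hs hst
      have h3 := hwork (t - l) ⟨hs0, hst.trans ht.2⟩
      have h4 := harr' (t - l) t hs0 hst ht.2 (by linarith)
      have h5 : 3 * c / 4 * ((t - (t - l)) * (5 * c / 4)⁻¹) ≤ l / 4 := by
        refine le_trans (mul_le_mul ?_ h1 ?_ ?_) (h2.trans h3)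
        · linarith
        · rw [sub_sub_cancel]; positivity
        · linarith
      have h6 : 3 * c / 4 * ((t - (t - l)) * (5 * c / 4)⁻¹) = 3 * l / 5 := by
        rw [sub_sub_cancel]; field_simp
      linarith
  intro t ht
  obtain ⟨n, hn⟩ := exists_nat_ge ((t - a) / l)
  rw [div_le_iff₀ hl] at hn
  exact hind n t ht (by linarith)

end Queue

theorem mass_fmu (μ : ℝ → Measure ℝ) {r : ℝ} (hr : 0 < r) (t : ℝ) :
    mass (fmu μ r t) = mass (μ (r * t)) / r := by
  unfold mass fmu
  rw [Measure.smul_apply, smul_eq_mul, ENNReal.toReal_mul,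
    ENNReal.toReal_ofReal (by positivity)]
  ring

theorem pair_fmu (g : ℝ → ℝ) (μ : ℝ → Measure ℝ) {r : ℝ} (hr : 0 < r) (t : ℝ) :
    pair g (fmu μ r t) = pair g (μ (r * t)) / r := by
  unfold pair fmu
  rw [integral_smul_measure, ENNReal.toReal_ofReal (by positivity), smul_eq_mul]
  ring

end PSQ

open PSQ in
/-- Lemma 3.3: stability of the fluid scaled queue length. -/
theorem stmt_2 (U v : ℕ → ℝ) (Z0 : ℕ) (vt : ℕ → ℝ) (hq : QueueHyps U v Z0 vt)
    (μ : ℝ → MeasureTheory.Measure ℝ) (S : ℝ → ℝ) (hstate : StateEqns U v Z0 vt μ S)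
    (T r : ℝ) (hT : 1 < T) (hr : 0 < r)
    (t0 t1 c l : ℝ) (ht0 : t0 ∈ Set.Icc 0 (r*T)) (ht1 : 0 < t1) (hc : 0 < c) (hl : 0 < l)
    (h1 : ∀ t ∈ Set.Icc t0 (t0+t1), fE U r (t+l) - fE U r t ≤ c/4)
    (h2 : ∀ t ∈ Set.Icc t0 (t0+t1), pair id (fmu μ r t) ≤ l/4)
    (h3 : mass (fmu μ r t0) ≤ c/2) :
    ∀ t ∈ Set.Icc t0 (t0+t1), mass (fmu μ r t) ≤ c := by
  have hmem : ∀ u ∈ Set.Icc (r * t0) (r * (t0 + t1)),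
      u / r ∈ Set.Icc t0 (t0 + t1) ∧ r * (u / r) = u := by
    intro u hu
    refine ⟨⟨?_, ?_⟩, by field_simp⟩
    · rw [le_div_iff₀ hr]; linarith [hu.1]
    · rw [div_le_iff₀ hr]; linarith [hu.2]
  have main := mass_le_of_bounds hq hstate (a := r * t0) (b := r * (t0 + t1)) (c := r * c)
    (l := r * l) (mul_nonneg hr.le ht0.1) (mul_pos hr hc) (mul_pos hr hl) ?_ ?_ ?_
  · intro t ht
    rw [mass_fmu μ hr, div_le_iff₀ hr, mul_comm c]
    exact main _ ⟨mul_le_mul_of_nonneg_left ht.1 hr.le, mul_le_mul_of_nonneg_left ht.2 hr.le⟩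
  · intro u hu
    obtain ⟨hu1, hu2⟩ := hmem u hu
    have := h1 _ hu1
    rw [fE, fE, mul_add, hu2, ← sub_div, div_le_iff₀ hr] at this
    linarith
  · intro u hu
    obtain ⟨hu1, hu2⟩ := hmem u hu
    have := h2 _ hu1
    rw [pair_fmu id μ hr, hu2, div_le_iff₀ hr] at this
    linarith
  · rw [mass_fmu μ hr, div_le_iff₀ hr] at h3
    linarith
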